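/- For every acceptance mode (σ,ρ) with σ ∈ {ran, inf} and ρ ∈ {⊓, ⊆, =}, the family of ω-languages (σ,ρ,nl)-accepted by context-free ω-grammars (via normal, i.e., not necessarily leftmost, derivations) is included in the family of ω-languages (σ,ρ)-accepted by pushdown ω-automata: 𝓛_{σ,ρ,nl}(ω-CFG) ⊆ 𝓛_{σ,ρ}(ω-PDA). -/

import Mathlib

namespace OmegaFormal

/-- σ component of an acceptance mode: `ran` (occurs at least once)
or `inf` (occurs infinitely often). -/
inductive AccSigma | ran | inf
deriving DecidableEq

/-- ρ component of an acceptance mode: `cap` (nonempty intersection, ⊓),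
`sub` (⊆) or `eq` (=). -/
inductive AccRho | cap | sub | eq
deriving DecidableEq

/-- derivation mode: leftmost (`l`) or normal (`nl`). -/
inductive DerivMode | l | nl
deriving DecidableEq

/-- `sigmaSet σ f` is ran(f) resp. inf(f). -/
def sigmaSet {Q : Type _} : AccSigma → (ℕ → Q) → Set Q
  | .ran, f => Set.range f
  | .inf, f => {q | ∀ n : ℕ, ∃ m : ℕ, n ≤ m ∧ f m = q}

/-- the binary relation denoted by ρ. -/
def rhoRel {Q : Type _} : AccRho → Set Q → Set Q → Prop
  | .cap, A, B => (A ∩ B).Nonempty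
  | .sub, A, B => A ⊆ B
  | .eq,  A, B => A = B

/-- f is (σ,ρ)-accepting w.r.t. the set 𝓕 of designated sets. -/
def IsAccepting {Q : Type _} (σ : AccSigma) (ρ : AccRho) (𝓕 : Set (Set Q)) (f : ℕ → Q) : Prop :=
  ∃ F ∈ 𝓕, rhoRel ρ (sigmaSet σ f) F

/-- the finite word `l` coincides with the prefix of the ω-word `u`. -/
def MatchesPrefix {T : Type _} (l : List T) (u : ℕ → T) : Prop :=
  ∀ (k : ℕ) (h : k < l.length), l.get ⟨k, h⟩ = u k

/-- the maximal terminal prefix of a sentential form. -/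
def termPrefix {N T : Type _} : List (N ⊕ T) → List T
  | [] => []
  | (Sum.inl _) :: _ => []
  | (Sum.inr a) :: l => a :: termPrefix l

/-- A phrase structure ω-grammar `G = (N, T, P, S, 𝓕)`:
`N` nonterminals, `T` terminals, `P` named productions `p : lhs p → rhs p`
with `lhs p ∈ N⁺`, `rhs p ∈ (N ∪ T)*`, start symbol, and
production repetition sets `acc ⊆ 2^P`. -/
structure OmegaPSG (T : Type) where
  N : Type
  [fintypeN : Fintype N]
  P : Type
  [fintypeP : Fintype P]
  lhs : P → List N
  lhs_ne : ∀ p : P, lhs p ≠ []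
  rhs : P → List (N ⊕ T)
  start : N
  acc : Set (Set P)

namespace OmegaPSG

variable {T : Type} (G : OmegaPSG T)

/-- one (normal) rewriting step using production p. -/
def Step (p : G.P) (x y : List (G.N ⊕ T)) : Prop :=
  ∃ u v : List (G.N ⊕ T),
    x = u ++ (G.lhs p).map Sum.inl ++ v ∧ y = u ++ G.rhs p ++ v

/-- one leftmost rewriting step: the rewritten occurrence starts at the
leftmost nonterminal, i.e. everything to its left is terminal. -/
def LStep (p : G.P) (x y : List (G.N ⊕ T)) : Prop :=
  ∃ u v : List (G.N ⊕ T), (∀ s ∈ u, ∃ a : T, s = Sum.inr a) ∧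
    x = u ++ (G.lhs p).map Sum.inl ++ v ∧ y = u ++ G.rhs p ++ v

def StepOf : DerivMode → G.P → List (G.N ⊕ T) → List (G.N ⊕ T) → Prop
  | .l => G.LStep
  | .nl => G.Step

/-- `L_{σ,ρ,π}(G)`: ω-words admitting an infinite π-derivation from S whose
growing terminal prefixes spell the word and whose production sequence is
(σ,ρ)-accepting w.r.t. `G.acc`. -/
def Lang (σ : AccSigma) (ρ : AccRho) (π : DerivMode) : Set (ℕ → T) :=
  {u | ∃ (s : ℕ → List (G.N ⊕ T)) (d : ℕ → G.P),
    s 0 = [Sum.inl G.start] ∧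
    (∀ i : ℕ, G.StepOf π (d i) (s i) (s (i + 1))) ∧
    (∀ n : ℕ, ∃ i : ℕ, n ≤ (termPrefix (s i)).length) ∧
    (∀ i : ℕ, MatchesPrefix (termPrefix (s i)) u) ∧
    IsAccepting σ ρ G.acc d}

/-- context-free: every left-hand side is a single nonterminal. -/
def IsCFG : Prop := ∀ p : G.P, (G.lhs p).length = 1

/-- context-sensitive (monotonic): `|β| ≥ |α|` for every production. -/
def IsCSG : Prop := ∀ p : G.P, (G.lhs p).length ≤ (G.rhs p).length

/-- right linear: productions of the form `A → uB` or `A → u`, `u ∈ T*`. -/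
def IsRLG : Prop :=
  ∀ p : G.P, (G.lhs p).length = 1 ∧
    ∃ (w : List T) (B : Option G.N),
      G.rhs p = w.map Sum.inr ++ B.toList.map Sum.inl

/-- `G` is a grammar with `$`-boundary (PSG version): with `$` = `dollar`,
`S` = `S'`, every production has one of the forms
(1) α → β, α,β ∈ N⁺ (N = nonterminals other than `$`, `S`),
(2) S → $α, α ∈ N⁺, (3) $A → a$, (4) A → ε. -/
def HasDollarBoundary (dollar S' : G.N) : Prop :=
  dollar ≠ S' ∧ G.start = S' ∧
  ∀ p : G.P,
    ((dollar ∉ G.lhs p ∧ S' ∉ G.lhs p) ∧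
      ∃ β : List G.N, β ≠ [] ∧ dollar ∉ β ∧ S' ∉ β ∧ G.rhs p = β.map Sum.inl) ∨
    (G.lhs p = [S'] ∧ ∃ α : List G.N, α ≠ [] ∧ dollar ∉ α ∧ S' ∉ α ∧
      G.rhs p = Sum.inl dollar :: α.map Sum.inl) ∨
    (∃ A : G.N, A ≠ dollar ∧ A ≠ S' ∧ G.lhs p = [dollar, A] ∧
      ∃ a : T, G.rhs p = [Sum.inr a, Sum.inl dollar]) ∨
    (∃ A : G.N, A ≠ dollar ∧ A ≠ S' ∧ G.lhs p = [A] ∧ G.rhs p = [])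

/-- `G` is a grammar with `$`-boundary (CSG version): forms (1)-(3) only,
with `|α| ≤ |β|` in form (1). -/
def HasDollarBoundaryCSG (dollar S' : G.N) : Prop :=
  dollar ≠ S' ∧ G.start = S' ∧
  ∀ p : G.P,
    ((dollar ∉ G.lhs p ∧ S' ∉ G.lhs p) ∧
      ∃ β : List G.N, β ≠ [] ∧ dollar ∉ β ∧ S' ∉ β ∧ (G.lhs p).length ≤ β.length ∧
        G.rhs p = β.map Sum.inl) ∨
    (G.lhs p = [S'] ∧ ∃ α : List G.N, α ≠ [] ∧ dollar ∉ α ∧ S' ∉ α ∧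
      G.rhs p = Sum.inl dollar :: α.map Sum.inl) ∨
    (∃ A : G.N, A ≠ dollar ∧ A ≠ S' ∧ G.lhs p = [dollar, A] ∧
      ∃ a : T, G.rhs p = [Sum.inr a, Sum.inl dollar])

end OmegaPSG

/-- `𝓛_{σ,ρ,π}(X)` for the family `X` of ω-grammars over `T` satisfying `C`. -/
def GLang (T : Type) (C : OmegaPSG T → Prop) (σ : AccSigma) (ρ : AccRho) (π : DerivMode) :
    Set (Set (ℕ → T)) :=
  {L | ∃ G : OmegaPSG T, C G ∧ L = G.Lang σ ρ π}

/-- number of non-ε labels among `b 0, …, b (i-1)`. -/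
def someCount {A : Type _} (b : ℕ → Option A) (i : ℕ) : ℕ :=
  ((Finset.range i).filter fun j => (b j).isSome = true).card

/-- the (ε-allowing) label sequence `b` concatenates to the ω-word `u`. -/
def Spells {A : Type _} (b : ℕ → Option A) (u : ℕ → A) : Prop :=
  (∀ n : ℕ, ∃ i : ℕ, n ≤ someCount b i) ∧
  ∀ i : ℕ, ∀ a : A, b i = some a → a = u (someCount b i)

/-- A finite state ω-automaton `(Q, Σ, δ, q₀, 𝓕)`. -/
structure OmegaFSA (Sig : Type) where
  Q : Type
  [fintypeQ : Fintype Q]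
  init : Q
  trans : Q → Option Sig → Q → Prop
  acc : Set (Set Q)

/-- `L_{σ,ρ}(A)` for a finite state ω-automaton. -/
def OmegaFSA.Lang {Sig : Type} (A : OmegaFSA Sig) (σ : AccSigma) (ρ : AccRho) :
    Set (ℕ → Sig) :=
  {u | ∃ (r : ℕ → A.Q) (b : ℕ → Option Sig),
    r 0 = A.init ∧ (∀ i : ℕ, A.trans (r i) (b i) (r (i + 1))) ∧
    Spells b u ∧ IsAccepting σ ρ A.acc r}

/-- `𝓛_{σ,ρ}(ω-FSA)`. -/
def FSALang (Sig : Type) (σ : AccSigma) (ρ : AccRho) : Set (Set (ℕ → Sig)) :=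
  {L | ∃ A : OmegaFSA Sig, L = A.Lang σ ρ}

/-- A pushdown ω-automaton `(Q, Σ, Γ, δ, q₀, Z₀, 𝓕)`. -/
structure OmegaPDA (Sig : Type) where
  Q : Type
  [fintypeQ : Fintype Q]
  Γ : Type
  [fintypeΓ : Fintype Γ]
  init : Q
  Z0 : Γ
  trans : Q → Option Sig → Γ → Q → List Γ → Prop
  acc : Set (Set Q)

/-- `L_{σ,ρ}(D)` for a pushdown ω-automaton. -/
def OmegaPDA.Lang {Sig : Type} (D : OmegaPDA Sig) (σ : AccSigma) (ρ : AccRho) :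
    Set (ℕ → Sig) :=
  {u | ∃ (q : ℕ → D.Q) (st : ℕ → List D.Γ) (b : ℕ → Option Sig),
    q 0 = D.init ∧ st 0 = [D.Z0] ∧
    (∀ i : ℕ, ∃ (Z : D.Γ) (γ rest : List D.Γ),
      st i = Z :: rest ∧ D.trans (q i) (b i) Z (q (i + 1)) γ ∧ st (i + 1) = γ ++ rest) ∧
    Spells b u ∧ IsAccepting σ ρ D.acc q}

/-- `𝓛_{σ,ρ}(ω-PDA)`. -/
def PDALang (Sig : Type) (σ : AccSigma) (ρ : AccRho) : Set (Set (ℕ → Sig)) :=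
  {L | ∃ D : OmegaPDA Sig, L = D.Lang σ ρ}

/-- tape head moves. -/
inductive Move | L | R | S
deriving DecidableEq

def moveHead : Move → ℕ → ℕ
  | .L, n => n - 1
  | .R, n => n + 1
  | .S, n => n

/-- A single-tape Turing ω-machine `(Q, Σ, Γ, δ, q₀, 𝓕)` (Σ ⊆ Γ via `embed`). -/
structure OmegaTM (Sig : Type) where
  Q : Type
  [fintypeQ : Fintype Q]
  Γ : Type
  [fintypeΓ : Fintype Γ]
  embed : Sig → Γ
  embed_inj : Function.Injective embed
  init : Q
  trans : Q → Γ → Q → Γ → Move → Prop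
  acc : Set (Set Q)

/-- `L_{σ,ρ}(M)`: ω-words admitting a complete non-oscillating run whose state
sequence is (σ,ρ)-accepting. -/
def OmegaTM.Lang {Sig : Type} (M : OmegaTM Sig) (σ : AccSigma) (ρ : AccRho) :
    Set (ℕ → Sig) :=
  {u | ∃ (q : ℕ → M.Q) (tape : ℕ → ℕ → M.Γ) (pos : ℕ → ℕ),
    q 0 = M.init ∧ (∀ n : ℕ, tape 0 n = M.embed (u n)) ∧ pos 0 = 0 ∧
    (∀ i : ℕ, ∃ (g : M.Γ) (m : Move),
      M.trans (q i) (tape i (pos i)) (q (i + 1)) g m ∧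
      tape (i + 1) = Function.update (tape i) (pos i) g ∧
      pos (i + 1) = moveHead m (pos i)) ∧
    (∀ n : ℕ, ∃ i : ℕ, n ≤ pos i) ∧
    (∀ n : ℕ, ∃ i0 : ℕ, ∀ i : ℕ, i0 ≤ i → pos i ≠ n) ∧
    IsAccepting σ ρ M.acc q}

/-- `𝓛_{σ,ρ}(ω-TM)`. -/
def TMLang (Sig : Type) (σ : AccSigma) (ρ : AccRho) : Set (Set (ℕ → Sig)) :=
  {L | ∃ M : OmegaTM Sig, L = M.Lang σ ρ}

/-- An m-tape Turing ω-machine. -/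
structure OmegaMTM (m : ℕ) (Sig : Type) where
  Q : Type
  [fintypeQ : Fintype Q]
  Γ : Type
  [fintypeΓ : Fintype Γ]
  embed : Sig → Γ
  embed_inj : Function.Injective embed
  blank : Γ
  init : Q
  trans : Q → (Fin m → Γ) → Q → (Fin m → Γ) → (Fin m → Move) → Prop
  acc : Set (Set Q)

/-- `L_{σ,ρ}(M)` for an m-tape Turing ω-machine (`hm : 0 < m`; the input is on
the first tape, the other tapes are initially blank; the run must be complete
and non-oscillating on the first tape). -/
def OmegaMTM.Lang {m : ℕ} {Sig : Type} (M : OmegaMTM m Sig) (hm : 0 < m)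
    (σ : AccSigma) (ρ : AccRho) : Set (ℕ → Sig) :=
  {u | ∃ (q : ℕ → M.Q) (tape : ℕ → Fin m → ℕ → M.Γ) (pos : ℕ → Fin m → ℕ),
    q 0 = M.init ∧
    (∀ n : ℕ, tape 0 ⟨0, hm⟩ n = M.embed (u n)) ∧
    (∀ j : Fin m, j ≠ ⟨0, hm⟩ → ∀ n : ℕ, tape 0 j n = M.blank) ∧
    (∀ j : Fin m, pos 0 j = 0) ∧
    (∀ i : ℕ, ∃ (g : Fin m → M.Γ) (mv : Fin m → Move),
      M.trans (q i) (fun j => tape i j (pos i j)) (q (i + 1)) g mv ∧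
      (∀ j : Fin m, tape (i + 1) j = Function.update (tape i j) (pos i j) (g j)) ∧
      (∀ j : Fin m, pos (i + 1) j = moveHead (mv j) (pos i j))) ∧
    (∀ n : ℕ, ∃ i : ℕ, n ≤ pos i ⟨0, hm⟩) ∧
    (∀ n : ℕ, ∃ i0 : ℕ, ∀ i : ℕ, i0 ≤ i → pos i ⟨0, hm⟩ ≠ n) ∧
    IsAccepting σ ρ M.acc q}

/-- `𝓛_{σ,ρ}(m-ω-TM)`. -/
def MTMLang (Sig : Type) (m : ℕ) (hm : 0 < m) (σ : AccSigma) (ρ : AccRho) :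
    Set (Set (ℕ → Sig)) :=
  {L | ∃ M : OmegaMTM m Sig, L = M.Lang hm σ ρ}

/-- the ω-language `{aⁿbⁿ | n ≥ 1}^ω` over the alphabet `Bool`
(`false` = a, `true` = b). -/
def abLang : Set (ℕ → Bool) :=
  {u | ∃ n : ℕ → ℕ, (∀ i : ℕ, 1 ≤ n i) ∧
    ∀ i k : ℕ, k < 2 * n i →
      u ((∑ j ∈ Finset.range i, 2 * n j) + k) = decide (n i ≤ k)}

end OmegaFormal
open OmegaFormal

namespace OmegaFormal

section Path

variable {C : Type*}

/-- `Path r c l c'`: the list `l` of successive targets leads from `c` to `c'` along `r`. -/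
def Path (r : C → C → Prop) : C → List C → C → Prop
  | c, [], c' => c = c'
  | c, x :: l, c' => r c x ∧ Path r x l c'

theorem Path.append {r : C → C → Prop} {c c' c'' : C} {l l' : List C}
    (h : Path r c l c') (h' : Path r c' l' c'') : Path r c (l ++ l') c'' := by
  induction l generalizing c with
  | nil => cases h; exact h'
  | cons x l ih => exact ⟨h.1, ih h.2⟩

theorem Path.exists_fun {r : C → C → Prop} {c c' : C} {l : List C} (h : Path r c l c') :
    ∃ g : ℕ → C, g 0 = c ∧ g l.length = c' ∧ (∀ j < l.length, r (g j) (g (j + 1))) ∧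
      ∀ x, x ∈ l ↔ ∃ j < l.length, g (j + 1) = x := by
  induction l generalizing c with
  | nil => exact ⟨fun _ => c, rfl, h, by simp, by simp⟩
  | cons y l ih =>
    obtain ⟨g, g0, g1, g2, g3⟩ := ih h.2
    refine ⟨fun j => Nat.casesOn j c g, rfl, g1, ?_, ?_⟩
    · rintro (_ | j) hj
      · simpa [g0] using h.1
      · exact g2 j (by simpa using hj)
    · intro x
      rw [List.mem_cons, g3]
      constructor
      · rintro (rfl | ⟨j, hj, rfl⟩)
        · exact ⟨0, by simp, g0⟩
        · exact ⟨j + 1, by simpa using hj, rfl⟩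
      · rintro ⟨_ | j, hj, rfl⟩
        · exact Or.inl g0
        · exact Or.inr ⟨j, by simpa using hj, rfl⟩

/-- Nonempty finite paths with matching end points concatenate to an infinite one. -/
theorem exists_infinite_path {r : C → C → Prop} {c : ℕ → C} {l : ℕ → List C}
    (hl : ∀ n, l n ≠ []) (hp : ∀ n, Path r (c n) (l n) (c (n + 1))) :
    ∃ f : ℕ → C, f 0 = c 0 ∧ (∀ i, r (f i) (f (i + 1))) ∧
      (∀ X : C → Prop, (∃ i, X (f (i + 1))) ↔ ∃ n, ∃ x ∈ l n, X x) ∧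
      ∀ X : C → Prop, (∀ m, ∃ i, m ≤ i ∧ X (f (i + 1))) ↔ ∀ m, ∃ n, m ≤ n ∧ ∃ x ∈ l n, X x := by
  choose g g0 g1 g2 g3 using fun n => (hp n).exists_fun
  let τ : ℕ → ℕ := fun n => ∑ k ∈ Finset.range n, (l k).length
  have τs : ∀ n, τ (n + 1) = τ n + (l n).length := fun n => Finset.sum_range_succ _ n
  have lpos : ∀ n, 0 < (l n).length := fun n => List.length_pos_of_ne_nil (hl n)
  have τm : StrictMono τ := strictMono_nat_of_lt_succ fun n => by
    have := τs n; have := lpos n; omega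
  have τ0 : τ 0 = 0 := by simp [τ]
  have loc : ∀ i, ∃ n, τ n ≤ i ∧ i < τ (n + 1) := by
    intro i
    induction i with
    | zero => exact ⟨0, by simp [τ0], by have := τs 0; have := lpos 0; omega⟩
    | succ i ih =>
      obtain ⟨n, h1, h2⟩ := ih
      by_cases h : i + 1 < τ (n + 1)
      · exact ⟨n, by omega, h⟩
      · exact ⟨n + 1, by omega, by have := τs (n + 1); have := lpos (n + 1); omega⟩
  choose ν ν1 ν2 using loc
  have νu : ∀ i n, τ n ≤ i → i < τ (n + 1) → ν i = n := by
    intro i n h1 h2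
    have a := τm.lt_iff_lt.1 (lt_of_le_of_lt h1 (ν2 i))
    have b := τm.lt_iff_lt.1 (lt_of_le_of_lt (ν1 i) h2)
    omega
  let f : ℕ → C := fun i => g (ν i) (i - τ (ν i))
  have fg : ∀ n j, j ≤ (l n).length → f (τ n + j) = g n j := by
    intro n j hj
    rcases lt_or_eq_of_le hj with hj | rfl
    · have : ν (τ n + j) = n := νu _ _ (by omega) (by have := τs n; omega)
      simp only [f, this]; congr 1; omega
    · have : ν (τ n + (l n).length) = n + 1 := νu _ _ (by have := τs n; omega)
        (by have := τs n; have := τs (n + 1); have := lpos (n + 1); omega)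
      simp only [f, this, τs, Nat.sub_self, g0, g1]
  have dec : ∀ i, ∃ j < (l (ν i)).length, i = τ (ν i) + j := fun i =>
    ⟨i - τ (ν i), by have := ν1 i; have := ν2 i; have := τs (ν i); omega, by have := ν1 i; omega⟩
  refine ⟨f, ?_, ?_, ?_, ?_⟩
  · have := fg 0 0 (Nat.zero_le _)
    simpa [τ0, g0] using this
  · intro i
    obtain ⟨j, hj, hi⟩ := dec i
    have a := fg (ν i) j hj.le
    have b := fg (ν i) (j + 1) hj
    rw [← hi] at a
    rw [← add_assoc, ← hi] at b
    rw [a, b]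
    exact g2 _ _ hj
  · intro X
    constructor
    · rintro ⟨i, hi⟩
      obtain ⟨j, hj, e⟩ := dec i
      have b := fg (ν i) (j + 1) hj
      rw [← add_assoc, ← e] at b
      exact ⟨ν i, _, (g3 _ _).2 ⟨j, hj, rfl⟩, b ▸ hi⟩
    · rintro ⟨n, x, hx, hX⟩
      obtain ⟨j, hj, rfl⟩ := (g3 _ _).1 hx
      exact ⟨τ n + j, by rwa [add_assoc, fg n (j + 1) hj]⟩
  · intro X
    constructor
    · intro h m
      obtain ⟨i, hmi, hi⟩ := h (τ m)
      obtain ⟨j, hj, e⟩ := dec i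
      have b := fg (ν i) (j + 1) hj
      rw [← add_assoc, ← e] at b
      have : m < ν i + 1 := τm.lt_iff_lt.1 (lt_of_le_of_lt hmi (ν2 i))
      exact ⟨ν i, by omega, _, (g3 _ _).2 ⟨j, hj, rfl⟩, b ▸ hi⟩
    · intro h m
      obtain ⟨n, hmn, x, hx, hX⟩ := h m
      obtain ⟨j, hj, rfl⟩ := (g3 _ _).1 hx
      have := τm.le_apply (x := n)
      exact ⟨τ n + j, by omega, by rwa [add_assoc, fg n (j + 1) hj]⟩

end Path

section Acceptance

variable {P Q : Type}

/-- Acceptance sets over states labelled with sets of productions. -/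
def labelAcc (ρ : AccRho) (lab : Q → Set P) (𝓕 : Set (Set P)) : Set (Set Q) :=
  {X | ∃ F ∈ 𝓕, match ρ with
    | .cap => X = {q | (lab q ∩ F).Nonempty}
    | .sub => (⋃ q ∈ X, lab q) ⊆ F
    | .eq => (⋃ q ∈ X, lab q) = F}

theorem isAccepting_labelAcc_iff [Finite Q] (σ : AccSigma) (ρ : AccRho) (lab : Q → Set P)
    (𝓕 : Set (Set P)) {d : ℕ → P} {q : ℕ → Q}
    (hran : ∀ p, (∃ t, d t = p) ↔ ∃ i, p ∈ lab (q i))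
    (hinf : ∀ p, (∀ m, ∃ t, m ≤ t ∧ d t = p) ↔ ∀ m, ∃ i, m ≤ i ∧ p ∈ lab (q i)) :
    IsAccepting σ ρ (labelAcc ρ lab 𝓕) q ↔ IsAccepting σ ρ 𝓕 d := by
  have key : sigmaSet σ d = ⋃ x ∈ sigmaSet σ q, lab x := by
    ext p
    cases σ with
    | ran => simpa [sigmaSet] using hran p
    | inf =>
      simp only [sigmaSet, Set.mem_ofPred_eq, hinf, Set.mem_iUnion, exists_prop]
      constructor
      · intro h
        by_contra! hc
        have : ∀ x : Q, ∃ n, ∀ m, n ≤ m → q m = x → p ∉ lab x := by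
          intro x
          by_cases hx : ∀ n, ∃ m, n ≤ m ∧ q m = x
          · exact ⟨0, fun _ _ _ => hc x hx⟩
          · push Not at hx
            obtain ⟨n, hn⟩ := hx
            exact ⟨n, fun m hm e => absurd e (hn m hm)⟩
        choose n hn using this
        obtain ⟨M, hM⟩ := (Set.finite_range n).bddAbove
        obtain ⟨i, hi, hp⟩ := h M
        exact hn (q i) i ((hM ⟨q i, rfl⟩).trans hi) rfl hp
      · rintro ⟨x, hx, hp⟩ m
        obtain ⟨i, hi, rfl⟩ := hx m
        exact ⟨i, hi, hp⟩
  unfold IsAccepting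
  rw [key]
  generalize sigmaSet σ q = A
  cases ρ with
  | cap =>
    simp only [labelAcc, rhoRel, Set.mem_ofPred_eq]
    constructor
    · rintro ⟨_, ⟨F, hF, rfl⟩, x, hx, p, hp, hpF⟩
      exact ⟨F, hF, p, Set.mem_biUnion hx hp, hpF⟩
    · rintro ⟨F, hF, p, hp, hpF⟩
      obtain ⟨x, hx, hp⟩ := Set.mem_iUnion₂.1 hp
      exact ⟨_, ⟨F, hF, rfl⟩, x, hx, p, hp, hpF⟩
  | sub =>
    simp only [labelAcc, rhoRel, Set.mem_ofPred_eq]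
    constructor
    · rintro ⟨X, ⟨F, hF, hX⟩, hA⟩
      exact ⟨F, hF, (Set.biUnion_mono hA fun _ _ => subset_rfl).trans hX⟩
    · rintro ⟨F, hF, h⟩
      exact ⟨A, ⟨F, hF, h⟩, subset_rfl⟩
  | eq =>
    simp only [labelAcc, rhoRel, Set.mem_ofPred_eq]
    constructor
    · rintro ⟨X, ⟨F, hF, hX⟩, rfl⟩
      exact ⟨F, hF, hX⟩
    · rintro ⟨F, hF, h⟩
      exact ⟨A, ⟨F, hF, h⟩, rfl⟩

end Acceptance

theorem exists_seq_of_step {α : Type*} {S : ℕ → α → Prop} {r : ℕ → α → α → Prop} {a : α}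
    (h0 : S 0 a) (h : ∀ n a, S n a → ∃ b, S (n + 1) b ∧ r n a b) :
    ∃ f : ℕ → α, f 0 = a ∧ ∀ n, S n (f n) ∧ r n (f n) (f (n + 1)) := by
  choose b hS hr using h
  let F : ∀ n, {a // S n a} := fun n =>
    Nat.rec ⟨a, h0⟩ (fun n x => ⟨b n x.1 x.2, hS n x.1 x.2⟩) n
  exact ⟨fun n => (F n).1, rfl, fun n => ⟨(F n).2, hr n _ (F n).2⟩⟩

section TermPrefix

variable {N T : Type*}

@[simp] theorem termPrefix_nil : termPrefix ([] : List (N ⊕ T)) = [] := rfl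

@[simp] theorem termPrefix_inl (A : N) (l : List (N ⊕ T)) : termPrefix (Sum.inl A :: l) = [] := rfl

@[simp] theorem termPrefix_map_inr_append (w : List T) (l : List (N ⊕ T)) :
    termPrefix (w.map Sum.inr ++ l) = w ++ termPrefix l := by
  induction w with
  | nil => rfl
  | cons a w ih => simp [termPrefix, ih]

theorem eq_map_inr_or (x : List (N ⊕ T)) :
    (∃ w : List T, x = w.map Sum.inr) ∨
      ∃ (w : List T) (A : N) (z : List (N ⊕ T)), x = w.map Sum.inr ++ Sum.inl A :: z := by
  induction x with
  | nil => exact Or.inl ⟨[], rfl⟩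
  | cons X x ih =>
    rcases X with A | a
    · exact Or.inr ⟨[], A, x, rfl⟩
    · rcases ih with ⟨w, rfl⟩ | ⟨w, A, z, rfl⟩
      · exact Or.inl ⟨a :: w, rfl⟩
      · exact Or.inr ⟨a :: w, A, z, rfl⟩

theorem termPrefix_append_of_not_terminal {x : List (N ⊕ T)} (hx : ¬∃ w : List T, x = w.map Sum.inr)
    (y : List (N ⊕ T)) : termPrefix (x ++ y) = termPrefix x := by
  rcases eq_map_inr_or x with h | ⟨w, A, z, rfl⟩
  · exact absurd h hx
  · simp

theorem MatchesPrefix.of_prefix {v w : List T} {u : ℕ → T} (hvw : v <+: w)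
    (h : MatchesPrefix w u) : MatchesPrefix v u := by
  obtain ⟨z, rfl⟩ := hvw
  intro k hk
  rw [← h k (by simp; omega)]
  simp [List.getElem_append_left hk]

theorem MatchesPrefix.of_append {v w : List T} {u : ℕ → T} {k : ℕ}
    (h : MatchesPrefix (v ++ w) fun j => u (k + j)) :
    MatchesPrefix w fun j => u (k + v.length + j) := by
  intro j hj
  have := h (v.length + j) (by simp; omega)
  simpa [add_assoc] using this

end TermPrefix

namespace OmegaPSG

variable {T : Type} {G : OmegaPSG T}

theorem IsCFG.lhs_eq (hG : G.IsCFG) (p : G.P) : ∃ A, G.lhs p = [A] :=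
  List.length_eq_one_iff.1 (hG p)

theorem Step.append {p : G.P} {x y : List (G.N ⊕ T)} (h : G.Step p x y) (a b : List (G.N ⊕ T)) :
    G.Step p (a ++ x ++ b) (a ++ y ++ b) := by
  obtain ⟨u, v, rfl, rfl⟩ := h
  exact ⟨a ++ u, v ++ b, by simp, by simp⟩

theorem Step.split (hG : G.IsCFG) {p : G.P} {x y z : List (G.N ⊕ T)} (h : G.Step p (x ++ y) z) :
    (∃ x', G.Step p x x' ∧ z = x' ++ y) ∨ ∃ y', G.Step p y y' ∧ z = x ++ y' := by
  obtain ⟨A, hA⟩ := hG.lhs_eq p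
  obtain ⟨u, v, h, rfl⟩ := h
  simp only [hA, List.map_cons, List.map_nil, List.append_assoc, List.singleton_append] at h
  rcases List.append_eq_append_iff.1 h with ⟨c, rfl, rfl⟩ | ⟨c, rfl, hc⟩
  · exact Or.inr ⟨c ++ G.rhs p ++ v, ⟨c, v, by simp [hA], rfl⟩, by simp⟩
  · rcases c with _ | ⟨X, c⟩
    · exact Or.inr ⟨G.rhs p ++ v, ⟨[], v, by simpa [hA] using hc.symm, rfl⟩, by simp⟩
    · simp only [List.cons_append, List.cons.injEq] at hc
      obtain ⟨rfl, rfl⟩ := hc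
      exact Or.inl ⟨u ++ G.rhs p ++ c, ⟨u, c, by simp [hA], rfl⟩, by simp⟩

theorem Step.termPrefix_prefix {p : G.P} {x y : List (G.N ⊕ T)} (h : G.Step p x y) :
    termPrefix x <+: termPrefix y := by
  obtain ⟨u, v, rfl, rfl⟩ := h
  obtain ⟨A, l, hA⟩ := List.exists_cons_of_ne_nil (G.lhs_ne p)
  rcases eq_map_inr_or u with ⟨w, rfl⟩ | ⟨w, B, z, rfl⟩
  · simp [hA]
  · simp

theorem not_step_terminal {p : G.P} {w : List T} {y : List (G.N ⊕ T)} :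
    ¬G.Step p (w.map Sum.inr) y := by
  rintro ⟨u, v, h, -⟩
  obtain ⟨A, l, hA⟩ := List.exists_cons_of_ne_nil (G.lhs_ne p)
  have : (Sum.inl A : G.N ⊕ T) ∈ w.map Sum.inr := by rw [h, hA]; simp
  simp at this

theorem Step.of_singleton (hG : G.IsCFG) {p : G.P} {B : G.N} {y : List (G.N ⊕ T)}
    (h : G.Step p [Sum.inl B] y) : G.lhs p = [B] ∧ y = G.rhs p := by
  obtain ⟨A, hA⟩ := hG.lhs_eq p
  obtain ⟨u, v, h, rfl⟩ := h
  simp only [hA, List.map_cons, List.map_nil, List.append_assoc, List.singleton_append] at h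
  rcases u with _ | ⟨X, u⟩
  · simp at h
    simp [hA, h]
  · simp at h

/-- `Derives G R x y`: a finite derivation from `x` to `y` whose set of productions is `R`. -/
inductive Derives (G : OmegaPSG T) : Set G.P → List (G.N ⊕ T) → List (G.N ⊕ T) → Prop
  | refl (x : List (G.N ⊕ T)) : Derives G ∅ x x
  | head {p : G.P} {R : Set G.P} {x y z : List (G.N ⊕ T)} :
      G.Step p x y → Derives G R y z → Derives G (insert p R) x z

theorem Derives.trans {R R' : Set G.P} {x y z : List (G.N ⊕ T)} (h : Derives G R x y)
    (h' : Derives G R' y z) : Derives G (R ∪ R') x z := by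
  induction h with
  | refl => simpa using h'
  | head hs _ ih => rw [Set.insert_union]; exact .head hs (ih h')

theorem Derives.single {p : G.P} {x y : List (G.N ⊕ T)} (h : G.Step p x y) :
    Derives G {p} x y := by
  simpa using Derives.head h (.refl y)

theorem Derives.append {R : Set G.P} {x y : List (G.N ⊕ T)} (h : Derives G R x y)
    (a b : List (G.N ⊕ T)) : Derives G R (a ++ x ++ b) (a ++ y ++ b) := by
  induction h with
  | refl => exact .refl _
  | head hs _ ih => exact .head (hs.append a b) ih

/-- Leftmost generation of the terminal word `w` from `x` with set of productions `R`. -/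
inductive Generates (G : OmegaPSG T) : Set G.P → List (G.N ⊕ T) → List T → Prop
  | nil : Generates G ∅ [] []
  | terminal {R : Set G.P} {x : List (G.N ⊕ T)} {w : List T} (a : T) :
      Generates G R x w → Generates G R (Sum.inr a :: x) (a :: w)
  | nonterminal {R : Set G.P} {x : List (G.N ⊕ T)} {w : List T} {p : G.P} {A : G.N} :
      G.lhs p = [A] → Generates G R (G.rhs p ++ x) w →
        Generates G (insert p R) (Sum.inl A :: x) w

theorem Generates.of_rewrite {p : G.P} {A : G.N} (hA : G.lhs p = [A]) {R : Set G.P}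
    {y : List (G.N ⊕ T)} {w : List T} (h : Generates G R y w) :
    ∀ a b, y = a ++ G.rhs p ++ b → Generates G (insert p R) (a ++ Sum.inl A :: b) w := by
  induction h with
  | nil =>
    rintro (_ | ⟨X, a⟩) b hy
    · exact .nonterminal hA (by simpa using hy ▸ Generates.nil)
    · simp at hy
  | @terminal R x w c hx ih =>
    rintro (_ | ⟨X, a⟩) b hy
    · have := Generates.terminal c hx
      rw [hy] at this
      exact .nonterminal hA (by simpa using this)
    · simp only [List.cons_append, List.cons.injEq] at hy
      obtain ⟨rfl, hy⟩ := hy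
      exact .terminal c (ih a b hy)
  | @nonterminal R x w q B hB hx ih =>
    rintro (_ | ⟨X, a⟩) b hy
    · have := Generates.nonterminal hB hx
      rw [hy] at this
      exact .nonterminal hA (by simpa using this)
    · simp only [List.cons_append, List.cons.injEq] at hy
      obtain ⟨rfl, hy⟩ := hy
      rw [Set.insert_comm]
      refine .nonterminal hB ?_
      have := ih (G.rhs q ++ a) b (by simp [hy])
      simpa using this

theorem Generates.of_terminal (w : List T) : Generates G ∅ (w.map Sum.inr) w := by
  induction w with
  | nil => exact .nil
  | cons a w ih => exact .terminal a ih

theorem Derives.generates (hG : G.IsCFG) {R : Set G.P} {x y : List (G.N ⊕ T)}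
    (h : Derives G R x y) : ∀ w : List T, y = w.map Sum.inr → Generates G R x w := by
  induction h with
  | refl => rintro w rfl; exact .of_terminal w
  | @head p R x y z hs _ ih =>
    intro w hw
    obtain ⟨A, hA⟩ := hG.lhs_eq p
    obtain ⟨u, v, rfl, rfl⟩ := hs
    simpa [hA] using (ih w hw).of_rewrite hA u v rfl

theorem Generates.append {R R' : Set G.P} {x y : List (G.N ⊕ T)} {v w : List T}
    (h : Generates G R x v) (h' : Generates G R' y w) :
    Generates G (R ∪ R') (x ++ y) (v ++ w) := by
  induction h with
  | nil => simpa using h'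
  | terminal a _ ih => exact .terminal a ih
  | nonterminal hA _ ih =>
    rw [Set.insert_union]
    exact .nonterminal hA (by simpa using ih)

/-- A form from which infinitely many successive finite derivations, each with set of
productions `J`, can be carried out. -/
def Loopable (G : OmegaPSG T) (J : Set G.P) (x : List (G.N ⊕ T)) : Prop :=
  ∃ γ : ℕ → List (G.N ⊕ T), γ 0 = x ∧ ∀ n, Derives G J (γ n) (γ (n + 1))

theorem loopable_empty (x : List (G.N ⊕ T)) : Loopable G ∅ x :=
  ⟨fun _ => x, rfl, fun _ => .refl x⟩

theorem Loopable.append {I J : Set G.P} {x y : List (G.N ⊕ T)} (hx : Loopable G I x)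
    (hy : Loopable G J y) : Loopable G (J ∪ I) (x ++ y) := by
  obtain ⟨γ, rfl, h⟩ := hx
  obtain ⟨δ, rfl, h'⟩ := hy
  refine ⟨fun n => γ n ++ δ n, rfl, fun n => ?_⟩
  have a := (h n).append [] (δ n)
  have b := (h' n).append (γ (n + 1)) []
  rw [Set.union_comm]
  simpa using a.trans (by simpa using b)

theorem Loopable.exists_derives {J : Set G.P} {x : List (G.N ⊕ T)} (h : Loopable G J x) :
    ∃ y, Derives G J x y ∧ Loopable G J y := by
  obtain ⟨γ, rfl, h⟩ := h
  exact ⟨γ 1, h 0, fun n => γ (n + 1), rfl, fun n => h (n + 1)⟩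

/-- After a finite derivation with production set `R`, the form `x` becomes loopable for `I`. -/
def Residue (G : OmegaPSG T) (x : List (G.N ⊕ T)) (R I : Set G.P) : Prop :=
  ∃ y, Derives G R x y ∧ Loopable G I y

/-- A derivation step or, for `none`, an idle step. -/
def StutterStep (G : OmegaPSG T) : Option G.P → List (G.N ⊕ T) → List (G.N ⊕ T) → Prop
  | none, x, y => y = x
  | some p, x, y => G.Step p x y

/-- An infinite sequence of derivation steps and idle steps. -/
def StutterDerivation (G : OmegaPSG T) (s : ℕ → List (G.N ⊕ T)) (d : ℕ → Option G.P) : Prop :=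
  ∀ t, G.StutterStep (d t) (s t) (s (t + 1))

namespace StutterDerivation

variable {s : ℕ → List (G.N ⊕ T)} {d : ℕ → Option G.P}

theorem termPrefix_prefix (h : G.StutterDerivation s d) {i j : ℕ} (hij : i ≤ j) :
    termPrefix (s i) <+: termPrefix (s j) := by
  induction j, hij using Nat.le_induction with
  | base => exact List.prefix_rfl
  | succ j _ ih =>
    have hj := h j
    cases hd : d j with
    | none => rw [hd] at hj; rwa [show s (j + 1) = s j from hj]
    | some p => rw [hd] at hj; exact ih.trans (Step.termPrefix_prefix hj)

theorem derives (h : G.StutterDerivation s d) {i j : ℕ} (hij : i ≤ j) :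
    Derives G {p | ∃ t, i ≤ t ∧ t < j ∧ d t = some p} (s i) (s j) := by
  induction j, hij using Nat.le_induction with
  | base =>
    convert Derives.refl (s i)
    ext p
    simp
    intros; omega
  | succ j hij ih =>
    have hj := h j
    cases hd : d j with
    | none =>
      rw [hd] at hj
      rw [show s (j + 1) = s j from hj]
      convert ih using 1
      ext p
      constructor
      · rintro ⟨t, h1, h2, h3⟩
        rcases Nat.lt_succ_iff_lt_or_eq.1 h2 with h2 | rfl
        · exact ⟨t, h1, h2, h3⟩
        · simp [hd] at h3
      · rintro ⟨t, h1, h2, h3⟩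
        exact ⟨t, h1, by omega, h3⟩
    | some q =>
      rw [hd] at hj
      convert ih.trans (Derives.single hj) using 1
      ext p
      constructor
      · rintro ⟨t, h1, h2, h3⟩
        rcases Nat.lt_succ_iff_lt_or_eq.1 h2 with h2 | rfl
        · exact Or.inl ⟨t, h1, h2, h3⟩
        · rw [hd] at h3
          exact Or.inr (Option.some.inj h3).symm
      · rintro (⟨t, h1, h2, h3⟩ | rfl)
        · exact ⟨t, h1, by omega, h3⟩
        · exact ⟨j, hij, by omega, hd⟩

theorem eq_of_forall_none (h : G.StutterDerivation s d) {i j : ℕ} (hij : i ≤ j)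
    (hd : ∀ t, i ≤ t → t < j → d t = none) : s j = s i := by
  induction j, hij using Nat.le_induction with
  | base => rfl
  | succ j hij ih =>
    have hj := h j
    rw [hd j hij (by omega)] at hj
    rw [show s (j + 1) = s j from hj, ih fun t h1 h2 => hd t h1 (by omega)]

theorem terminal (h : G.StutterDerivation s d) {i j : ℕ} (hij : i ≤ j) {w : List T}
    (hw : s i = w.map Sum.inr) : s j = w.map Sum.inr ∧ d j = none := by
  have key : ∀ j, s j = w.map Sum.inr → d j = none := by
    intro j hj
    cases hd : d j with
    | none => rfl
    | some p =>
      have := h j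
      rw [hd, hj] at this
      exact absurd this not_step_terminal
  have hs : s j = w.map Sum.inr := by
    induction j, hij using Nat.le_induction with
    | base => exact hw
    | succ j _ ih =>
      have hj := h j
      rw [key j ih] at hj
      rw [show s (j + 1) = s j from hj, ih]
  exact ⟨hs, key j hs⟩

theorem split (hG : G.IsCFG) (h : G.StutterDerivation s d) {x y : List (G.N ⊕ T)}
    (h0 : s 0 = x ++ y) :
    ∃ sx dx sy dy, G.StutterDerivation sx dx ∧ G.StutterDerivation sy dy ∧ sx 0 = x ∧ sy 0 = y ∧
      (∀ t, s t = sx t ++ sy t) ∧ ∀ t q, d t = some q ↔ dx t = some q ∨ dy t = some q := by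
  obtain ⟨F, F0, hF⟩ := exists_seq_of_step (a := (x, y)) (S := fun t z => s t = z.1 ++ z.2)
    (r := fun t z z' => ∃ o : Option G.P × Option G.P, G.StutterStep o.1 z.1 z'.1 ∧
      G.StutterStep o.2 z.2 z'.2 ∧ ∀ q, d t = some q ↔ o.1 = some q ∨ o.2 = some q) h0 (by
    rintro t ⟨x, y⟩ hxy
    have ht := h t
    rw [hxy] at ht
    cases hd : d t with
    | none =>
      rw [hd] at ht
      exact ⟨(x, y), ht, (none, none), rfl, rfl, by simp⟩
    | some p =>
      rw [hd] at ht
      rcases Step.split hG ht with ⟨x', hx, e⟩ | ⟨y', hy, e⟩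
      · exact ⟨(x', y), e, (some p, none), hx, rfl, by simp⟩
      · exact ⟨(x, y'), e, (none, some p), rfl, hy, by simp⟩)
  choose hs o ho using hF
  exact ⟨fun t => (F t).1, fun t => (o t).1, fun t => (F t).2, fun t => (o t).2,
    fun t => (ho t).1, fun t => (ho t).2.1, by simp [F0], by simp [F0], hs, fun t => (ho t).2.2⟩

theorem exists_residue (h : G.StutterDerivation s d) :
    ∃ R I, Residue G (s 0) R I ∧ (∀ p, p ∈ R ∪ I ↔ ∃ t, d t = some p) ∧
      ∀ p, p ∈ I ↔ ∀ m, ∃ t, m ≤ t ∧ d t = some p := by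
  have := G.fintypeP
  let I : Set G.P := {p | ∀ m, ∃ t, m ≤ t ∧ d t = some p}
  have hfin : ∃ t₀, ∀ t, t₀ ≤ t → ∀ p, d t = some p → p ∈ I := by
    have : ∀ p, ∃ m, ∀ t, m ≤ t → d t = some p → p ∈ I := by
      intro p
      by_cases hp : p ∈ I
      · exact ⟨0, fun _ _ _ => hp⟩
      · have hp' : ¬∀ m, ∃ t, m ≤ t ∧ d t = some p := hp
        push Not at hp'
        obtain ⟨m, hm⟩ := hp'
        exact ⟨m, fun t ht e => absurd e (hm t ht)⟩
    choose m hm using this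
    obtain ⟨M, hM⟩ := (Set.finite_range m).bddAbove
    exact ⟨M, fun t ht p => hm p t ((hM ⟨p, rfl⟩).trans ht)⟩
  obtain ⟨t₀, ht₀⟩ := hfin
  have hblock : ∀ m, t₀ ≤ m → ∃ m', m ≤ m' ∧ Derives G I (s m) (s m') := by
    intro m hm
    have : ∀ p, ∃ t, p ∈ I → m ≤ t ∧ d t = some p := by
      intro p
      by_cases hp : p ∈ I
      · obtain ⟨t, ht⟩ := hp m
        exact ⟨t, fun _ => ht⟩
      · exact ⟨0, fun h => absurd h hp⟩
    choose t ht using this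
    obtain ⟨M, hM⟩ := (Set.finite_range t).bddAbove
    refine ⟨max m (M + 1), le_max_left _ _, ?_⟩
    convert h.derives (le_max_left m (M + 1)) using 1
    ext p
    constructor
    · intro hp
      have := hM ⟨p, rfl⟩
      exact ⟨t p, (ht p hp).1, lt_max_of_lt_right (by omega), (ht p hp).2⟩
    · rintro ⟨t, h1, -, h3⟩
      exact ht₀ t (hm.trans h1) p h3
  obtain ⟨f, f0, hf⟩ := exists_seq_of_step (S := fun _ m => t₀ ≤ m)
    (r := fun _ m m' => Derives G I (s m) (s m')) le_rfl fun _ m hm => by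
      obtain ⟨m', h1, h2⟩ := hblock m hm
      exact ⟨m', hm.trans h1, h2⟩
  refine ⟨_, I, ⟨s t₀, h.derives (Nat.zero_le t₀), fun n => s (f n), congrArg s f0,
    fun n => (hf n).2⟩, ?_, fun _ => Iff.rfl⟩
  intro p
  constructor
  · rintro (⟨t, -, -, h3⟩ | hp)
    · exact ⟨t, h3⟩
    · obtain ⟨t, -, ht⟩ := hp 0
      exact ⟨t, ht⟩
  · rintro ⟨t, ht⟩
    rcases lt_or_ge t t₀ with h1 | h1
    · exact Or.inl ⟨t, Nat.zero_le _, h1, ht⟩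
    · exact Or.inr (ht₀ t h1 p ht)

end StutterDerivation

/-- Splits the initial form of a derivation at the nonterminal that generates infinitely many
letters: what precedes it generates a finite word, what follows it is never needed. -/
theorem StutterDerivation.exists_spine (hG : G.IsCFG) (l : List (G.N ⊕ T)) :
    ∀ s d, G.StutterDerivation s d → s 0 = l → (∀ n, ∃ i, n ≤ (termPrefix (s i)).length) →
    ∃ (α : List (G.N ⊕ T)) (B : G.N) (β : List (G.N ⊕ T)) (D : ℕ → Set G.P) (w : List T) (τ : ℕ)
      (s' : ℕ → List (G.N ⊕ T)) (d' : ℕ → Option G.P) (sβ : ℕ → List (G.N ⊕ T))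
      (dβ : ℕ → Option G.P),
      l = α ++ Sum.inl B :: β ∧ Generates G {q | ∃ t, q ∈ D t} α w ∧ (∀ t, τ ≤ t → D t = ∅) ∧
      (∀ t, τ ≤ t → w ++ termPrefix (s' t) <+: termPrefix (s t)) ∧
      (∀ t, (termPrefix (s t)).length ≤ w.length + (termPrefix (s' t)).length) ∧
      G.StutterDerivation s' d' ∧ s' 0 = [Sum.inl B] ∧
      (∀ n, ∃ i, n ≤ (termPrefix (s' i)).length) ∧
      G.StutterDerivation sβ dβ ∧ sβ 0 = β ∧
      ∀ t q, d t = some q ↔ q ∈ D t ∨ d' t = some q ∨ dβ t = some q := by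
  induction l with
  | nil =>
    intro s d h h0 hu
    obtain ⟨i, hi⟩ := hu 1
    rw [(h.terminal (Nat.zero_le i) (w := []) h0).1] at hi
    simp at hi
  | cons X l ih =>
    intro s d h h0 hu
    obtain ⟨sx, dx, sy, dy, hx, hy, hx0, hy0, hs, hd⟩ := h.split hG (x := [X]) (y := l) h0
    by_cases hT : ∃ τ, ∃ w : List T, sx τ = w.map Sum.inr
    · obtain ⟨τ, w, hw⟩ := hT
      have hge : ∀ t, τ ≤ t → termPrefix (s t) = w ++ termPrefix (sy t) := by
        intro t ht
        rw [hs, (hx.terminal ht hw).1, termPrefix_map_inr_append]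
      have hle : ∀ t, (termPrefix (s t)).length ≤ w.length + (termPrefix (sy t)).length := by
        intro t
        by_cases ht : ∃ v : List T, sx t = v.map Sum.inr
        · obtain ⟨v, hv⟩ := ht
          have : v = w := by
            have a := (hx.terminal (le_max_left t τ) hv).1
            rw [(hx.terminal (le_max_right t τ) hw).1] at a
            exact (List.map_injective_iff.2 Sum.inr_injective a).symm
          rw [hs, hv, termPrefix_map_inr_append, this, List.length_append]
        · have a := (hx.termPrefix_prefix (le_max_left t τ)).length_le
          rw [(hx.terminal (le_max_right t τ) hw).1] at a
          have b := termPrefix_map_inr_append w ([] : List (G.N ⊕ T))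
          simp only [List.append_nil, termPrefix_nil] at b
          rw [b] at a
          rw [hs, termPrefix_append_of_not_terminal ht]
          omega
      obtain ⟨α, B, β, D, v, τ', s', d', sβ, dβ, rfl, hgen, hD, hpre, hlen, h', h'0, h'u, hβ, hβ0,
        hd'⟩ := ih sy dy hy hy0 (by
          intro n
          obtain ⟨i, hi⟩ := hu (w.length + n)
          exact ⟨i, by have := hle i; omega⟩)
      refine ⟨X :: α, B, β, fun t => {q | dx t = some q} ∪ D t, w ++ v, max τ τ', s', d', sβ, dβ,
        rfl, ?_, ?_, ?_, ?_, h', h'0, h'u, hβ, hβ0, ?_⟩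
      · have a := ((hx.derives (Nat.zero_le τ)).generates hG w hw).append hgen
        rw [hx0, List.singleton_append] at a
        convert a using 1
        ext q
        constructor
        · rintro ⟨t, ht | ht⟩
          · refine Or.inl ⟨t, Nat.zero_le _, ?_, ht⟩
            by_contra hc
            rw [Set.mem_ofPred_eq, (hx.terminal (not_lt.1 hc) hw).2] at ht
            simp at ht
          · exact Or.inr ⟨t, ht⟩
        · rintro (⟨t, -, -, ht⟩ | ⟨t, ht⟩)
          · exact ⟨t, Or.inl ht⟩
          · exact ⟨t, Or.inr ht⟩
      · intro t ht
        rw [max_le_iff] at ht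
        simp [hD t ht.2, (hx.terminal ht.1 hw).2]
      · intro t ht
        rw [max_le_iff] at ht
        rw [hge t ht.1, List.append_assoc]
        exact (List.prefix_append_right_inj _).2 (hpre t ht.2)
      · intro t
        have a := hle t
        have b := hlen t
        rw [List.length_append]
        omega
      · intro t q
        rw [hd, hd']
        simp only [Set.mem_union, Set.mem_ofPred_eq]
        tauto
    · have hst : ∀ t, termPrefix (s t) = termPrefix (sx t) := by
        intro t
        rw [hs, termPrefix_append_of_not_terminal fun h => hT ⟨t, h⟩]
      rcases X with B | a
      · refine ⟨[], B, l, fun _ => ∅, [], 0, sx, dx, sy, dy, rfl, ?_, fun _ _ => rfl, ?_, ?_, hx,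
          hx0, ?_, hy, hy0, ?_⟩
        · simpa using Generates.nil
        · simp [hst]
        · simp [hst]
        · simpa [hst] using hu
        · simpa using hd
      · exact absurd ⟨0, [a], hx0⟩ hT

/-- A derivation from the nonterminal `B` that generates the letters of `u` from position `k` on. -/
structure SpineDerivation (G : OmegaPSG T) (u : ℕ → T) (k : ℕ) (B : G.N)
    (s : ℕ → List (G.N ⊕ T)) (d : ℕ → Option G.P) : Prop where
  derivation : G.StutterDerivation s d
  start : s 0 = [Sum.inl B]
  unbounded : ∀ n, ∃ i, n ≤ (termPrefix (s i)).length
  spells : ∀ i, MatchesPrefix (termPrefix (s i)) fun j => u (k + j)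

theorem SpineDerivation.exists_next (hG : G.IsCFG) {u : ℕ → T} {k : ℕ} {B : G.N}
    {s : ℕ → List (G.N ⊕ T)} {d : ℕ → Option G.P} (h : SpineDerivation G u k B s d) :
    ∃ (p : G.P) (α : List (G.N ⊕ T)) (B' : G.N) (β : List (G.N ⊕ T)) (w : List T)
      (K R I : Set G.P) (F : ℕ → Set G.P) (s' : ℕ → List (G.N ⊕ T)) (d' : ℕ → Option G.P),
      (G.lhs p = [B] ∧ G.rhs p = α ++ Sum.inl B' :: β ∧ Generates G K α w ∧ Residue G β R I ∧
        MatchesPrefix w fun j => u (k + j)) ∧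
      SpineDerivation G u (k + w.length) B' s' d' ∧
      (∀ t, (termPrefix (s t)).length ≤ w.length + (termPrefix (s' t)).length) ∧
      (∀ n, (∀ t < n, d t = none) → ∀ t < n + 1, d' t = none) ∧
      (∀ t q, d t = some q ↔ q ∈ F t ∨ d' t = some q) ∧
      (∀ q, (q = p ∨ q ∈ R ∨ q ∈ K ∨ q ∈ I) ↔ ∃ t, q ∈ F t) ∧
      ∀ q, q ∈ I ↔ ∀ m, ∃ t, m ≤ t ∧ q ∈ F t := by
  classical
  have hex : ∃ t, (d t).isSome = true := by
    by_contra! hc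
    obtain ⟨i, hi⟩ := h.unbounded 1
    rw [h.derivation.eq_of_forall_none (Nat.zero_le i) (fun t _ _ => by simpa using hc t),
      h.start] at hi
    simp at hi
  obtain ⟨t₁, ht₁, hmin⟩ : ∃ t, (d t).isSome = true ∧ ∀ t' < t, d t' = none :=
    ⟨Nat.find hex, Nat.find_spec hex, fun t' ht' => by simpa using Nat.find_min hex ht'⟩
  obtain ⟨p, hp⟩ := Option.isSome_iff_exists.1 ht₁
  have hB : ∀ t ≤ t₁, s t = [Sum.inl B] := fun t ht => by
    rw [h.derivation.eq_of_forall_none (Nat.zero_le t) fun t' _ ht' => hmin t' (by omega), h.start]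
  have hstep := h.derivation t₁
  rw [hp, hB t₁ le_rfl] at hstep
  obtain ⟨hlhs, hrhs⟩ := Step.of_singleton hG hstep
  let s₁ : ℕ → List (G.N ⊕ T) := fun t => s (max t (t₁ + 1))
  let d₁ : ℕ → Option G.P := fun t => if t ≤ t₁ then none else d t
  have h₁ : G.StutterDerivation s₁ d₁ := by
    intro t
    by_cases ht : t ≤ t₁
    · simp only [s₁, d₁, if_pos ht, max_eq_right (show t ≤ t₁ + 1 by omega),
        max_eq_right (show t + 1 ≤ t₁ + 1 by omega)]
      rfl
    · simp only [s₁, d₁, if_neg ht, max_eq_left (show t₁ + 1 ≤ t by omega),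
        max_eq_left (show t₁ + 1 ≤ t + 1 by omega)]
      exact h.derivation t
  have hss₁ : ∀ t, (termPrefix (s t)).length ≤ (termPrefix (s₁ t)).length := fun t =>
    (h.derivation.termPrefix_prefix (le_max_left t (t₁ + 1))).length_le
  obtain ⟨α, B', β, D, w, τ, s', d', sβ, dβ, hl, hgen, hD, hpre, hlen, h', h'0, h'u, hβ, hβ0, hd⟩ :=
    StutterDerivation.exists_spine hG (G.rhs p) s₁ d₁ h₁ (by simp [s₁, hrhs]) (by
      intro n
      obtain ⟨i, hi⟩ := h.unbounded n
      exact ⟨i, hi.trans (hss₁ i)⟩)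
  obtain ⟨R, I, hres, hRI, hI⟩ := hβ.exists_residue
  rw [hβ0] at hres
  have hnone : ∀ t ≤ t₁, D t = ∅ ∧ d' t = none ∧ dβ t = none := by
    intro t ht
    have a := hd t
    simp only [d₁, if_pos ht, reduceCtorEq, false_iff, not_or] at a
    exact ⟨Set.eq_empty_of_forall_notMem fun q => (a q).1,
      Option.eq_none_iff_forall_ne_some.2 fun q => (a q).2.1,
      Option.eq_none_iff_forall_ne_some.2 fun q => (a q).2.2⟩
  refine ⟨p, α, B', β, w, _, R, I, fun t => {q | t = t₁ ∧ q = p ∨ q ∈ D t ∨ dβ t = some q}, s', d',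
    ⟨hlhs, hl, hgen, hres, ?_⟩, ⟨h', h'0, h'u, ?_⟩, fun t => (hss₁ t).trans (hlen t), ?_, ?_, ?_, ?_⟩
  · exact (h.spells (max τ (t₁ + 1))).of_prefix ((List.prefix_append _ _).trans (hpre τ le_rfl))
  · intro t
    have a := (h.spells _).of_prefix (hpre (max t τ) (le_max_right _ _))
    exact a.of_append.of_prefix (h'.termPrefix_prefix (le_max_left t τ))
  · intro n hn t ht
    refine (hnone t ?_).2.1
    by_contra hc
    have := hn t₁ (by omega)
    simp [hp] at this
  · intro t q
    rcases lt_trichotomy t t₁ with ht | rfl | ht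
    · obtain ⟨a, b, c⟩ := hnone t ht.le
      simp [hmin t ht, a, b, c, ht.ne]
    · obtain ⟨a, b, c⟩ := hnone t le_rfl
      simp [hp, a, b, c, eq_comm]
    · have := hd t q
      simp only [d₁, if_neg (not_le.2 ht)] at this
      rw [this]
      simp only [Set.mem_ofPred_eq, ht.ne', false_and, false_or]
      tauto
  · intro q
    have := hRI q
    rw [Set.mem_union] at this
    simp only [Set.mem_ofPred_eq, exists_or, ← this, exists_and_right, exists_eq, true_and]
    tauto
  · intro q
    rw [hI]
    constructor
    · intro hq m
      obtain ⟨t, h1, h2⟩ := hq m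
      exact ⟨t, h1, Or.inr (Or.inr h2)⟩
    · intro hq m
      obtain ⟨t, h1, ⟨rfl, -⟩ | h2 | h2⟩ := hq (max m (max τ (t₁ + 1)))
      · simp at h1
      · rw [hD t (by simp at h1; omega)] at h2
        exact absurd h2 (Set.notMem_empty q)
      · exact ⟨t, (le_max_left _ _).trans h1, h2⟩

/-- Removing the idle steps of a derivation with infinitely many proper steps. -/
theorem StutterDerivation.exists_derivation {s : ℕ → List (G.N ⊕ T)} {d : ℕ → Option G.P}
    (h : G.StutterDerivation s d) (hd : ∀ m, ∃ t, m ≤ t ∧ (d t).isSome = true) :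
    ∃ (e : ℕ → ℕ) (d' : ℕ → G.P), (∀ t, t ≤ e t) ∧ s (e 0) = s 0 ∧
      (∀ i, G.Step (d' i) (s (e i)) (s (e (i + 1)))) ∧
      (∀ q, (∃ i, d' i = q) ↔ ∃ t, d t = some q) ∧
      ∀ q, (∀ m, ∃ i, m ≤ i ∧ d' i = q) ↔ ∀ m, ∃ t, m ≤ t ∧ d t = some q := by
  have hinf : {t | (d t).isSome = true}.Infinite := by
    refine Set.infinite_of_not_bddAbove ?_
    rintro ⟨M, hM⟩
    obtain ⟨t, ht, hs⟩ := hd (M + 1)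
    have := hM hs
    omega
  let e : ℕ → ℕ := Nat.nth fun t => (d t).isSome = true
  have hmono : StrictMono e := Nat.nth_strictMono hinf
  have hsome : ∀ i, ∃ p, d (e i) = some p := fun i =>
    Option.isSome_iff_exists.1 (Nat.nth_mem_of_infinite hinf i)
  have hrange : ∀ t q, d t = some q → ∃ i, e i = t := by
    intro t q ht
    have : t ∈ Set.range e := by
      rw [Nat.range_nth_of_infinite hinf]
      simp [ht]
    exact this
  choose d' hd' using hsome
  refine ⟨e, d', fun t => hmono.le_apply, ?_, ?_, ?_, ?_⟩
  · refine h.eq_of_forall_none (Nat.zero_le _) fun t _ ht => ?_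
    refine Option.eq_none_iff_forall_ne_some.2 fun q hq => ?_
    obtain ⟨i, rfl⟩ := hrange t q hq
    have := hmono.lt_iff_lt.1 ht
    omega
  · intro i
    have hstep := h (e i)
    rw [hd' i] at hstep
    have : s (e (i + 1)) = s (e i + 1) := by
      refine h.eq_of_forall_none (hmono (Nat.lt_succ_self i)) fun t ht ht' => ?_
      refine Option.eq_none_iff_forall_ne_some.2 fun q hq => ?_
      obtain ⟨j, rfl⟩ := hrange t q hq
      have := hmono.lt_iff_lt.1 ht'
      have := hmono.lt_iff_lt.1 (show e i < e j from ht)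
      omega
    rw [this]
    exact hstep
  · intro q
    constructor
    · rintro ⟨i, rfl⟩
      exact ⟨e i, hd' i⟩
    · rintro ⟨t, ht⟩
      obtain ⟨i, rfl⟩ := hrange t q ht
      exact ⟨i, Option.some.inj ((hd' i).symm.trans ht)⟩
  · intro q
    constructor
    · intro hq m
      obtain ⟨i, hi, rfl⟩ := hq m
      exact ⟨e i, hi.trans hmono.le_apply, hd' i⟩
    · intro hq m
      obtain ⟨t, hmt, ht⟩ := hq (e m)
      obtain ⟨i, rfl⟩ := hrange t q ht
      exact ⟨i, hmono.le_iff_le.1 hmt, Option.some.inj ((hd' i).symm.trans ht)⟩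

theorem Derives.exists_path {R : Set G.P} {x y : List (G.N ⊕ T)} (h : Derives G R x y) :
    ∀ o : Option G.P, ∃ l : List (List (G.N ⊕ T) × Option G.P),
      Path (fun c c' => G.StutterStep c'.2 c.1 c'.1) (x, o) l (y, none) ∧ (y, none) ∈ l ∧
      ∀ q, (∃ z ∈ l, z.2 = some q) ↔ q ∈ R := by
  induction h with
  | refl x => exact fun o => ⟨[(x, none)], ⟨rfl, rfl⟩, by simp, by simp⟩
  | @head p R x y z hs _ ih =>
    intro o
    obtain ⟨l, hl, hm, hq⟩ := ih (some p)
    refine ⟨(y, some p) :: l, ⟨hs, hl⟩, List.mem_cons_of_mem _ hm, fun q => ?_⟩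
    simp only [List.mem_cons, exists_eq_or_imp, hq, Option.some.injEq, Set.mem_insert_iff]
    rw [eq_comm]

end OmegaPSG

namespace OmegaPDA

variable {T : Type}

/-- A run step on configurations that record the number of letters of `u` read so far. -/
def RunStep {Q Γ : Type} (trans : Q → Option T → Γ → Q → List Γ → Prop) (u : ℕ → T)
    (c c' : Q × List Γ × ℕ) : Prop :=
  ∃ (b : Option T) (Z : Γ) (γ rest : List Γ), c.2.1 = Z :: rest ∧ trans c.1 b Z c'.1 γ ∧
    c'.2.1 = γ ++ rest ∧ (b = none ∧ c'.2.2 = c.2.2 ∨ b = some (u c.2.2) ∧ c'.2.2 = c.2.2 + 1)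

theorem mem_lang_iff (D : OmegaPDA T) (σ : AccSigma) (ρ : AccRho) (u : ℕ → T) :
    u ∈ D.Lang σ ρ ↔ ∃ f : ℕ → D.Q × List D.Γ × ℕ, f 0 = (D.init, [D.Z0], 0) ∧
      (∀ i, RunStep D.trans u (f i) (f (i + 1))) ∧ (∀ n, ∃ i, n ≤ (f i).2.2) ∧
      IsAccepting σ ρ D.acc fun i => (f i).1 := by
  have hcount : ∀ (b : ℕ → Option T) i,
      someCount b (i + 1) = someCount b i + if (b i).isSome = true then 1 else 0 := by
    intro b i
    unfold someCount
    rw [Finset.range_add_one, Finset.filter_insert]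
    split_ifs <;> simp
  constructor
  · rintro ⟨q, st, b, hq, hst, hstep, hsp, hacc⟩
    refine ⟨fun i => (q i, st i, someCount b i), ?_, ?_, hsp.1, hacc⟩
    · simp [hq, hst, someCount]
    · intro i
      obtain ⟨Z, γ, rest, h1, h2, h3⟩ := hstep i
      refine ⟨b i, Z, γ, rest, h1, h2, h3, ?_⟩
      simp only [hcount]
      cases hb : b i with
      | none => simp
      | some a => simp [hsp.2 i a hb]
  · rintro ⟨f, f0, hf, hu, hacc⟩
    choose b hb using hf
    have hk : ∀ i, someCount b i = (f i).2.2 := by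
      intro i
      induction i with
      | zero => simp [someCount, f0]
      | succ i ih =>
        obtain ⟨Z, γ, rest, -, -, -, ⟨h, h'⟩ | ⟨h, h'⟩⟩ := hb i <;> simp [hcount, ih, h, h']
    refine ⟨fun i => (f i).1, fun i => (f i).2.1, b, by simp [f0], by simp [f0], ?_, ?_, hacc⟩
    · intro i
      obtain ⟨Z, γ, rest, h1, h2, h3, -⟩ := hb i
      exact ⟨Z, γ, rest, h1, h2, h3⟩
    · refine ⟨by simpa [hk] using hu, fun i a ha => ?_⟩
      obtain ⟨Z, γ, rest, -, -, -, ⟨h, -⟩ | ⟨h, -⟩⟩ := hb i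
      · simp [h] at ha
      · rw [hk]
        exact (Option.some.inj (h.symm.trans ha)).symm

end OmegaPDA

namespace OmegaPSG

variable {T : Type} {G : OmegaPSG T}

/-- Transitions of the automaton simulating the derivations of `G`. The bottom symbol `inr B` is the
nonterminal that generates infinitely many letters, the symbols above it are those still to be
turned into a finite word. The forms to the right of the bottom symbol are not stored: a state
`(J, L)` consists of the set `J` of productions that they use over and over again and of the set
`L` of productions used by the last transition. -/
inductive SimTrans (G : OmegaPSG T) : Set G.P × Set G.P → Option T → (G.N ⊕ T) ⊕ G.N →
    Set G.P × Set G.P → List ((G.N ⊕ T) ⊕ G.N) → Prop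
  | idle (J L : Set G.P) (Z : (G.N ⊕ T) ⊕ G.N) : SimTrans G (J, L) none Z (J, ∅) [Z]
  | read (J L : Set G.P) (a : T) : SimTrans G (J, L) (some a) (Sum.inl (Sum.inr a)) (J, ∅) []
  | expand (J L : Set G.P) {p : G.P} {A : G.N} : G.lhs p = [A] →
      SimTrans G (J, L) none (Sum.inl (Sum.inl A)) (J, {p}) ((G.rhs p).map Sum.inl)
  | spine (J L : Set G.P) {p : G.P} {B B' : G.N} {α β : List (G.N ⊕ T)} {R I : Set G.P} :
      G.lhs p = [B] → G.rhs p = α ++ Sum.inl B' :: β → Residue G β R I →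
      SimTrans G (J, L) none (Sum.inr B) (J ∪ I, insert p R) (α.map Sum.inl ++ [Sum.inr B'])

open Classical in
/-- The pushdown automaton simulating the derivations of `G`. -/
noncomputable def simPDA [Fintype T] (G : OmegaPSG T) (ρ : AccRho) : OmegaPDA T where
  Q := Set G.P × Set G.P
  fintypeQ := have := G.fintypeP; Fintype.ofFinite _
  Γ := (G.N ⊕ T) ⊕ G.N
  fintypeΓ := have := G.fintypeN; inferInstance
  init := (∅, ∅)
  Z0 := Sum.inr G.start
  trans := G.SimTrans
  acc := labelAcc ρ (fun q => q.1 ∪ q.2) G.acc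

section Simulation

/-- Configurations of the simulating automaton. -/
abbrev SimConfig (G : OmegaPSG T) : Type :=
  (Set G.P × Set G.P) × List ((G.N ⊕ T) ⊕ G.N) × ℕ

variable {u : ℕ → T}

theorem Generates.exists_path {K : Set G.P} {x : List (G.N ⊕ T)} {w : List T}
    (h : Generates G K x w) (J : Set G.P) (rest : List ((G.N ⊕ T) ⊕ G.N)) :
    ∀ (k : ℕ) (L : Set G.P), (MatchesPrefix w fun j => u (k + j)) →
    ∃ (l : List (SimConfig G)) (L' : Set G.P),
      Path (OmegaPDA.RunStep G.SimTrans u) ((J, L), x.map Sum.inl ++ rest, k) l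
        ((J, L'), rest, k + w.length) ∧
      (∀ c ∈ l, c.1.1 = J) ∧ ∀ q, q ∈ K ↔ ∃ c ∈ l, q ∈ c.1.2 := by
  induction h with
  | nil => exact fun k L _ => ⟨[], L, rfl, by simp, by simp⟩
  | @terminal R x w a _ ih =>
    intro k L hw
    obtain ⟨l, L', h1, h2, h3⟩ := ih (k + 1) ∅
      (MatchesPrefix.of_append (v := [a]) (u := u) (k := k) hw)
    have ha : a = u k := hw 0 (by simp)
    refine ⟨((J, ∅), x.map Sum.inl ++ rest, k + 1) :: l, L',
      ⟨⟨some a, _, _, _, rfl, SimTrans.read J L a, rfl, Or.inr ⟨by rw [ha], rfl⟩⟩, ?_⟩, ?_, ?_⟩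
    · rw [List.length_cons, add_comm w.length 1, ← add_assoc]
      exact h1
    · simpa using h2
    · simpa using h3
  | @nonterminal R x w p A hA _ ih =>
    intro k L hw
    obtain ⟨l, L', h1, h2, h3⟩ := ih k {p} hw
    rw [List.map_append, List.append_assoc] at h1
    refine ⟨((J, {p}), (G.rhs p).map Sum.inl ++ (x.map Sum.inl ++ rest), k) :: l, L',
      ⟨⟨none, _, _, _, rfl, SimTrans.expand J L hA, rfl, Or.inl ⟨rfl, rfl⟩⟩, h1⟩, ?_, ?_⟩
    · simpa using h2
    · intro q
      simp only [Set.mem_insert_iff, List.mem_cons, exists_eq_or_imp, Set.mem_singleton_iff, h3]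

theorem exists_spine_path {p : G.P} {B B' : G.N} {α β : List (G.N ⊕ T)} {w : List T}
    {K R I : Set G.P} {k : ℕ} (hl : G.lhs p = [B]) (hr : G.rhs p = α ++ Sum.inl B' :: β)
    (hgen : Generates G K α w) (hres : Residue G β R I)
    (hw : MatchesPrefix w fun j => u (k + j)) (J : Set G.P) :
    ∃ l : List (SimConfig G),
      Path (OmegaPDA.RunStep G.SimTrans u) ((J, ∅), [Sum.inr B], k) l
        ((J ∪ I, ∅), [Sum.inr B'], k + w.length) ∧
      (∃ c ∈ l, c.2.2 = k + w.length) ∧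
      ∀ q, (∃ c ∈ l, q ∈ c.1.1 ∪ c.1.2) ↔ q ∈ J ∪ I ∨ q = p ∨ q ∈ R ∨ q ∈ K := by
  obtain ⟨l, L', h1, h2, h3⟩ := hgen.exists_path (J ∪ I) [Sum.inr B'] k (insert p R) hw
  let c₁ : SimConfig G := ((J ∪ I, insert p R), α.map Sum.inl ++ [Sum.inr B'], k)
  let c₂ : SimConfig G := ((J ∪ I, ∅), [Sum.inr B'], k + w.length)
  refine ⟨c₁ :: (l ++ [c₂]), ⟨⟨none, _, _, [], rfl, SimTrans.spine J ∅ hl hr hres, by simp [c₁],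
    Or.inl ⟨rfl, rfl⟩⟩, h1.append ⟨⟨none, _, _, [], rfl, SimTrans.idle _ L' _, by simp [c₂],
    Or.inl ⟨rfl, rfl⟩⟩, rfl⟩⟩, ⟨c₂, by simp, rfl⟩, ?_⟩
  intro q
  constructor
  · rintro ⟨c, hc, hq⟩
    simp only [List.mem_cons, List.mem_append, List.not_mem_nil, or_false] at hc
    rcases hc with rfl | hc | rfl
    · rcases hq with hq | rfl | hq
      · exact Or.inl hq
      · exact Or.inr (Or.inl rfl)
      · exact Or.inr (Or.inr (Or.inl hq))
    · rcases hq with hq | hq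
      · rw [h2 c hc] at hq
        exact Or.inl hq
      · exact Or.inr (Or.inr (Or.inr ((h3 q).2 ⟨c, hc, hq⟩)))
    · rcases hq with hq | hq
      · exact Or.inl hq
      · exact absurd hq (Set.notMem_empty q)
  · rintro (hq | rfl | hq | hq)
    · exact ⟨c₁, by simp, Or.inl hq⟩
    · exact ⟨c₁, by simp, Or.inr (Or.inl rfl)⟩
    · exact ⟨c₁, by simp, Or.inr (Or.inr hq)⟩
    · obtain ⟨c, hc, hq⟩ := (h3 q).1 hq
      exact ⟨c, by simp [hc], Or.inr hq⟩

/-- Peeling off the productions `F n` of a sequence of derivations one after the other: `J n`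
collects the productions occurring infinitely often in one of the first `n` layers. -/
theorem exists_layer_iff {P : Type*} {d : ℕ → ℕ → Option P} {F : ℕ → ℕ → Set P} {J : ℕ → Set P}
    (hnone : ∀ n, ∀ t < n, d n t = none)
    (hpeel : ∀ n t q, d n t = some q ↔ q ∈ F n t ∨ d (n + 1) t = some q) (hJ0 : J 0 = ∅)
    (hJ : ∀ n q, q ∈ J (n + 1) ↔ q ∈ J n ∨ ∀ m, ∃ t, m ≤ t ∧ q ∈ F n t) (q : P) :
    ((∃ t, d 0 t = some q) ↔ ∃ n, q ∈ J n ∨ ∃ t, q ∈ F n t) ∧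
      ((∀ m, ∃ t, m ≤ t ∧ d 0 t = some q) ↔ ∀ m, ∃ n, m ≤ n ∧ (q ∈ J n ∨ ∃ t, q ∈ F n t)) := by
  have hpeels : ∀ n t, d 0 t = some q ↔ (∃ m < n, q ∈ F m t) ∨ d n t = some q := by
    intro n t
    induction n with
    | zero => simp
    | succ n ih =>
      rw [ih, hpeel n]
      constructor
      · rintro (⟨m, hm, h⟩ | h | h)
        · exact Or.inl ⟨m, by omega, h⟩
        · exact Or.inl ⟨n, by omega, h⟩
        · exact Or.inr h
      · rintro (⟨m, hm, h⟩ | h)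
        · rcases Nat.lt_succ_iff_lt_or_eq.1 hm with hm | rfl
          · exact Or.inl ⟨m, hm, h⟩
          · exact Or.inr (Or.inl h)
        · exact Or.inr (Or.inr h)
  have hlayer : ∀ t, d 0 t = some q ↔ ∃ n, q ∈ F n t := by
    intro t
    constructor
    · intro h
      rcases (hpeels (t + 1) t).1 h with ⟨m, -, h⟩ | h
      · exact ⟨m, h⟩
      · simp [hnone (t + 1) t (Nat.lt_succ_self t)] at h
    · rintro ⟨n, h⟩
      exact (hpeels (n + 1) t).2 (Or.inl ⟨n, Nat.lt_succ_self n, h⟩)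
  have hle : ∀ n t, q ∈ F n t → n ≤ t := by
    intro n t h
    by_contra! hlt
    have := (hpeel n t q).2 (Or.inl h)
    simp [hnone n t hlt] at this
  have hJs : ∀ n, q ∈ J n ↔ ∃ m < n, ∀ M, ∃ t, M ≤ t ∧ q ∈ F m t := by
    intro n
    induction n with
    | zero => simp [hJ0]
    | succ n ih =>
      rw [hJ, ih]
      constructor
      · rintro (⟨m, hm, h⟩ | h)
        · exact ⟨m, by omega, h⟩
        · exact ⟨n, by omega, h⟩
      · rintro ⟨m, hm, h⟩
        rcases Nat.lt_succ_iff_lt_or_eq.1 hm with hm | rfl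
        · exact Or.inl ⟨m, hm, h⟩
        · exact Or.inr h
  refine ⟨⟨?_, ?_⟩, ?_, ?_⟩
  · rintro ⟨t, h⟩
    obtain ⟨n, h⟩ := (hlayer t).1 h
    exact ⟨n, Or.inr ⟨t, h⟩⟩
  · rintro ⟨n, h | ⟨t, h⟩⟩
    · obtain ⟨m, -, h⟩ := (hJs n).1 h
      obtain ⟨t, -, h⟩ := h 0
      exact ⟨t, (hlayer t).2 ⟨m, h⟩⟩
    · exact ⟨t, (hlayer t).2 ⟨n, h⟩⟩
  · intro h m
    by_contra! hc
    have hbound : ∀ n, ∃ M, ∀ t, M ≤ t → q ∉ F n t := by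
      intro n
      rcases lt_or_ge n m with hn | hn
      · by_contra! hinf
        exact (hc m le_rfl).1 ((hJs m).2 ⟨n, hn, hinf⟩)
      · exact ⟨0, fun t _ => (hc n hn).2 t⟩
    choose M hM using hbound
    obtain ⟨t, ht, hq⟩ := h ((Finset.range m).sup M)
    obtain ⟨n, hn⟩ := (hlayer t).1 hq
    rcases lt_or_ge n m with hnm | hnm
    · exact hM n t ((Finset.le_sup (Finset.mem_range.2 hnm)).trans ht) hn
    · exact (hc n hnm).2 t hn
  · intro h m
    obtain ⟨n, hmn, hn | ⟨t, hn⟩⟩ := h m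
    · obtain ⟨k, -, hk⟩ := (hJs n).1 hn
      obtain ⟨t, ht, hq⟩ := hk m
      exact ⟨t, ht, (hlayer t).2 ⟨k, hq⟩⟩
    · exact ⟨t, hmn.trans (hle n t hn), (hlayer t).2 ⟨n, hn⟩⟩

theorem exists_succ_iff {X : ℕ → Prop} (h : ¬X 0) : (∃ i, X i) ↔ ∃ i, X (i + 1) :=
  ⟨fun ⟨i, hi⟩ => match i, hi with
    | 0, hi => absurd hi h
    | i + 1, hi => ⟨i, hi⟩, fun ⟨i, hi⟩ => ⟨i + 1, hi⟩⟩

theorem forall_exists_le_succ_iff {X : ℕ → Prop} :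
    (∀ m, ∃ i, m ≤ i ∧ X i) ↔ ∀ m, ∃ i, m ≤ i ∧ X (i + 1) := by
  constructor
  · intro h m
    obtain ⟨i, hi, hX⟩ := h (m + 1)
    exact ⟨i - 1, by omega, by rwa [Nat.sub_add_cancel (by omega)]⟩
  · intro h m
    obtain ⟨i, hi, hX⟩ := h m
    exact ⟨i + 1, by omega, hX⟩

theorem mem_simPDA_lang_iff [Fintype T] {σ : AccSigma} {ρ : AccRho} :
    u ∈ (simPDA G ρ).Lang σ ρ ↔ ∃ f : ℕ → SimConfig G, f 0 = ((∅, ∅), [Sum.inr G.start], 0) ∧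
      (∀ i, OmegaPDA.RunStep G.SimTrans u (f i) (f (i + 1))) ∧ (∀ n, ∃ i, n ≤ (f i).2.2) ∧
      IsAccepting σ ρ (labelAcc ρ (fun q : Set G.P × Set G.P => q.1 ∪ q.2) G.acc)
        fun i => (f i).1 :=
  OmegaPDA.mem_lang_iff _ σ ρ u

theorem mem_simPDA_lang [Fintype T] (hG : G.IsCFG) {σ : AccSigma} {ρ : AccRho}
    (hu : u ∈ G.Lang σ ρ .nl) : u ∈ (simPDA G ρ).Lang σ ρ := by
  have := G.fintypeP
  obtain ⟨s₀, d₀, hs0, hstep, hunb, hsp, hacc⟩ := hu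
  have hspine₀ : SpineDerivation G u 0 G.start s₀ fun t => some (d₀ t) :=
    ⟨hstep, hs0, hunb, by simpa using hsp⟩
  obtain ⟨Y, Y0, hY⟩ := exists_seq_of_step
    (a := ((0, G.start, s₀, fun t => some (d₀ t), ∅) :
      ℕ × G.N × (ℕ → List (G.N ⊕ T)) × (ℕ → Option G.P) × Set G.P))
    (S := fun n y => SpineDerivation G u y.1 y.2.1 y.2.2.1 y.2.2.2.1 ∧ ∀ t < n, y.2.2.2.1 t = none)
    (r := fun _ y y' => ∃ (l : List (SimConfig G)) (F : ℕ → Set G.P),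
      Path (OmegaPDA.RunStep G.SimTrans u) ((y.2.2.2.2, ∅), [Sum.inr y.2.1], y.1) l
        ((y'.2.2.2.2, ∅), [Sum.inr y'.2.1], y'.1) ∧
      (∃ c ∈ l, c.2.2 = y'.1) ∧
      (∀ t, y.1 + (termPrefix (y.2.2.1 t)).length ≤ y'.1 + (termPrefix (y'.2.2.1 t)).length) ∧
      (∀ t q, y.2.2.2.1 t = some q ↔ q ∈ F t ∨ y'.2.2.2.1 t = some q) ∧
      (∀ q, (∃ c ∈ l, q ∈ c.1.1 ∪ c.1.2) ↔ q ∈ y.2.2.2.2 ∨ ∃ t, q ∈ F t) ∧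
      ∀ q, q ∈ y'.2.2.2.2 ↔ q ∈ y.2.2.2.2 ∨ ∀ m, ∃ t, m ≤ t ∧ q ∈ F t)
    ⟨hspine₀, by simp⟩ (by
      rintro n ⟨k, B, s, d, J⟩ ⟨hspine, hd⟩
      obtain ⟨p, α, B', β, w, K, R, I, F, s', d', ⟨h1, h2, h3, h4, h5⟩, hspine', hlen, hnone, hF,
        hran, hinf⟩ := hspine.exists_next hG
      obtain ⟨l, hpath, hc, hl⟩ := exists_spine_path h1 h2 h3 h4 h5 J
      refine ⟨(k + w.length, B', s', d', J ∪ I), ⟨hspine', hnone n hd⟩, l, F, hpath, hc, ?_, hF,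
        ?_, ?_⟩
      · intro t
        have := hlen t
        dsimp only at this ⊢
        omega
      · intro q
        rw [hl, ← hran, Set.mem_union]
        tauto
      · intro q
        rw [← hinf, Set.mem_union])
  choose hS l F hpath hread hlen hpeel hlab hJ using hY
  have hlayer := exists_layer_iff (d := fun n => (Y n).2.2.2.1) (J := fun n => (Y n).2.2.2.2)
    (fun n => (hS n).2) hpeel (by simp [Y0]) hJ
  obtain ⟨f, f0, hf, hran, hinf⟩ := exists_infinite_path
    (fun n => by obtain ⟨c, hc, -⟩ := hread n; exact List.ne_nil_of_mem hc) hpath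
  simp only [Y0, Option.some.injEq] at hlayer f0
  refine mem_simPDA_lang_iff.2 ⟨f, f0, hf, ?_, ?_⟩
  · intro N
    obtain ⟨t, ht⟩ := hunb N
    have htel : ∀ n, (termPrefix (s₀ t)).length ≤
        (Y n).1 + (termPrefix ((Y n).2.2.1 t)).length := by
      intro n
      induction n with
      | zero => simp [Y0]
      | succ n ih => exact ih.trans (hlen n t)
    have hk := htel (t + 1)
    rw [(hS (t + 1)).1.derivation.eq_of_forall_none (Nat.zero_le t)
      (fun t' _ h => (hS (t + 1)).2 t' (by omega)), (hS (t + 1)).1.start] at hk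
    obtain ⟨c, hc, hck⟩ := hread t
    obtain ⟨i, hi⟩ := (hran fun c => N ≤ c.2.2).2 ⟨t, c, hc, by
      rw [hck]
      simpa using ht.trans hk⟩
    exact ⟨i + 1, hi⟩
  · refine (isAccepting_labelAcc_iff σ ρ _ G.acc (d := d₀) (fun q => ?_) fun q => ?_).2 hacc
    · rw [(hlayer q).1]
      refine ((exists_succ_iff (by simp [f0])).trans
        ((hran fun c => q ∈ c.1.1 ∪ c.1.2).trans ?_)).symm
      exact exists_congr fun n => hlab n q
    · rw [(hlayer q).2]
      refine (forall_exists_le_succ_iff.trans ((hinf fun c => q ∈ c.1.1 ∪ c.1.2).trans ?_)).symm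
      exact forall_congr' fun m => exists_congr fun n => and_congr_right fun _ => hlab n q

/-- The sentential form of a simulating configuration after reading `k` letters of `u`, with
stack contents `x`, spine nonterminal `B` and forms `g` to the right of the spine. -/
def simForm (u : ℕ → T) (k : ℕ) (z : List (G.N ⊕ T) × G.N × List (G.N ⊕ T)) : List (G.N ⊕ T) :=
  ((List.range k).map u).map Sum.inr ++ (z.1 ++ Sum.inl z.2.1 :: z.2.2)

theorem simForm_succ (k : ℕ) (x : List (G.N ⊕ T)) (B : G.N) (g : List (G.N ⊕ T)) :
    simForm u (k + 1) (x, B, g) = simForm u k (Sum.inr (u k) :: x, B, g) := by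
  simp [simForm, List.range_succ]

theorem Derives.simForm {J : Set G.P} {g g' : List (G.N ⊕ T)} (h : Derives G J g g') (k : ℕ)
    (x : List (G.N ⊕ T)) (B : G.N) :
    Derives G J (simForm u k (x, B, g)) (simForm u k (x, B, g')) := by
  have := h.append (((List.range k).map u).map Sum.inr ++ (x ++ [Sum.inl B])) []
  simp only [List.append_assoc, List.append_nil, List.singleton_append] at this
  exact this

theorem exists_derives_of_runStep {c c' : SimConfig G} (h : OmegaPDA.RunStep G.SimTrans u c c')
    {x : List (G.N ⊕ T)} {B : G.N} {g : List (G.N ⊕ T)}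
    (hst : c.2.1 = x.map Sum.inl ++ [Sum.inr B]) (hg : Loopable G c.1.1 g) :
    ∃ z : List (G.N ⊕ T) × G.N × List (G.N ⊕ T),
      (c'.2.1 = z.1.map Sum.inl ++ [Sum.inr z.2.1] ∧ Loopable G c'.1.1 z.2.2) ∧
      Derives G (c'.1.1 ∪ c'.1.2) (simForm u c.2.2 (x, B, g)) (simForm u c'.2.2 z) := by
  obtain ⟨q, st, k⟩ := c
  obtain ⟨q', st', k'⟩ := c'
  obtain ⟨b, Z, γ, rest, h1, htr, h3, h4⟩ := h
  dsimp only at *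
  subst h1 h3
  cases htr with
  | idle J L =>
    obtain ⟨g', hd, hg'⟩ := hg.exists_derives
    obtain rfl : k' = k := by simpa using h4
    exact ⟨(x, B, g'), ⟨hst, hg'⟩, by simpa using hd.simForm k' x B⟩
  | read J L a =>
    obtain ⟨g', hd, hg'⟩ := hg.exists_derives
    obtain ⟨rfl, rfl⟩ : a = u k ∧ k' = k + 1 := by simpa using h4
    rcases x with _ | ⟨X, x⟩
    · simp at hst
    · simp only [List.map_cons, List.cons_append, List.cons.injEq, Sum.inl.injEq] at hst
      obtain ⟨rfl, rfl⟩ := hst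
      refine ⟨(x, B, g'), ⟨rfl, hg'⟩, ?_⟩
      rw [simForm_succ]
      simpa using hd.simForm k _ B
  | @expand J L p A hA =>
    obtain ⟨g', hd, hg'⟩ := hg.exists_derives
    obtain rfl : k' = k := by simpa using h4
    rcases x with _ | ⟨X, x⟩
    · simp at hst
    · simp only [List.map_cons, List.cons_append, List.cons.injEq, Sum.inl.injEq] at hst
      obtain ⟨rfl, rfl⟩ := hst
      refine ⟨(G.rhs p ++ x, B, g'), ⟨by simp, hg'⟩, ?_⟩
      rw [Set.union_comm]
      refine (Derives.single ?_).trans (hd.simForm k' _ B)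
      exact ⟨((List.range k').map u).map Sum.inr, x ++ Sum.inl B :: g, by simp [simForm, hA],
        by simp [simForm]⟩
  | @spine J L p B₀ B' α β R I hl hr hres =>
    obtain rfl : k' = k := by simpa using h4
    rcases x with _ | ⟨X, x⟩
    · simp only [List.map_nil, List.nil_append, List.cons.injEq, Sum.inr.injEq] at hst
      obtain ⟨rfl, rfl⟩ := hst
      obtain ⟨β', hβ, hβ'⟩ := hres
      obtain ⟨g', hd, hg'⟩ := (hβ'.append hg).exists_derives
      refine ⟨(α, B', g'), ⟨by simp, hg'⟩, ?_⟩
      rw [Set.union_comm, Set.insert_union]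
      refine .head (y := simForm u k' (α, B', β ++ g)) ?_
        (Derives.trans ?_ (hd.simForm k' α B'))
      · exact ⟨((List.range k').map u).map Sum.inr, g, by simp [simForm, hl],
          by simp [simForm, hr]⟩
      · simpa using (hβ.append [] g).simForm k' α B'
    · simp at hst

theorem mem_lang_of_mem_simPDA_lang [Fintype T] {σ : AccSigma} {ρ : AccRho}
    (hu : u ∈ (simPDA G ρ).Lang σ ρ) : u ∈ G.Lang σ ρ .nl := by
  have := G.fintypeP
  obtain ⟨f, f0, hf, hunb, hacc⟩ := mem_simPDA_lang_iff.1 hu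
  obtain ⟨z, z0, hz⟩ := exists_seq_of_step
    (a := (([], G.start, []) : List (G.N ⊕ T) × G.N × List (G.N ⊕ T)))
    (S := fun n z => (f n).2.1 = z.1.map Sum.inl ++ [Sum.inr z.2.1] ∧ Loopable G (f n).1.1 z.2.2)
    (r := fun n z z' => Derives G ((f (n + 1)).1.1 ∪ (f (n + 1)).1.2)
      (simForm u (f n).2.2 z) (simForm u (f (n + 1)).2.2 z'))
    ⟨by simp [f0], by simpa [f0] using loopable_empty []⟩
    fun n _ h => exists_derives_of_runStep (hf n) h.1 h.2
  choose l hpath hmem hlab using fun n => (hz n).2.exists_path none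
  obtain ⟨F, F0, hder, hran, hinf⟩ := exists_infinite_path
    (fun n => List.ne_nil_of_mem (hmem n)) hpath
  let s : ℕ → List (G.N ⊕ T) := fun t => (F t).1
  let d : ℕ → Option G.P := fun t => (F (t + 1)).2
  have hsd : G.StutterDerivation s d := hder
  have hreach : ∀ m, ∃ t k, m ≤ k ∧ (List.range k).map u <+: termPrefix (s t) := by
    intro m
    obtain ⟨i, hi⟩ := hunb (m + 1)
    rcases i with _ | n
    · simp [f0] at hi
    · obtain ⟨t, ht⟩ := (hran fun c => c.1 = simForm u (f (n + 1)).2.2 (z (n + 1))).2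
        ⟨n, _, hmem n, rfl⟩
      refine ⟨t + 1, (f (n + 1)).2.2, by omega, ?_⟩
      rw [show s (t + 1) = _ from ht, simForm, termPrefix_map_inr_append]
      exact List.prefix_append _ _
  have hlen : ∀ m, ∃ t, m ≤ (termPrefix (s t)).length := by
    intro m
    obtain ⟨t, k, hk, hp⟩ := hreach m
    exact ⟨t, hk.trans (by simpa using hp.length_le)⟩
  have hspell : ∀ t, MatchesPrefix (termPrefix (s t)) u := by
    intro t
    obtain ⟨t', k, hk, hp⟩ := hreach (termPrefix (s t)).length
    refine MatchesPrefix.of_prefix (w := (List.range k).map u) ?_ fun j hj => by simp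
    rcases le_total t t' with h | h
    · exact List.prefix_of_prefix_length_le (hsd.termPrefix_prefix h) hp (by simpa using hk)
    · exact List.prefix_of_prefix_length_le List.prefix_rfl (hp.trans (hsd.termPrefix_prefix h))
        (by simpa using hk)
  have hsome : ∀ m, ∃ t, m ≤ t ∧ (d t).isSome = true := by
    intro m
    by_contra! hc
    obtain ⟨t, ht⟩ := hlen ((termPrefix (s m)).length + 1)
    rcases le_total t m with h | h
    · have := (hsd.termPrefix_prefix h).length_le
      omega
    · rw [hsd.eq_of_forall_none h fun t h _ => by simpa using hc t h] at ht
      omega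
  obtain ⟨e, d', he, he0, hstep, hran', hinf'⟩ := hsd.exists_derivation hsome
  refine ⟨fun i => s (e i), d', ?_, hstep, ?_, fun i => hspell _, ?_⟩
  · simp [he0, s, F0, z0, f0, simForm]
  · intro m
    obtain ⟨t, ht⟩ := hlen m
    exact ⟨t, ht.trans (hsd.termPrefix_prefix (he t)).length_le⟩
  · refine (isAccepting_labelAcc_iff σ ρ _ G.acc (fun q => ?_) fun q => ?_).1 hacc
    · refine (hran' q).trans (((hran fun c => c.2 = some q).trans ?_).trans
        (exists_succ_iff (by simp [f0])).symm)
      exact exists_congr fun n => hlab n q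
    · refine (hinf' q).trans (((hinf fun c => c.2 = some q).trans ?_).trans
        forall_exists_le_succ_iff.symm)
      exact forall_congr' fun m => exists_congr fun n => and_congr_right fun _ => hlab n q

end Simulation

end OmegaPSG

end OmegaFormal

/-- Theorem: 𝓛_{σ,ρ,nl}(ω-CFG) ⊆ 𝓛_{σ,ρ}(ω-PDA) for every acceptance mode (σ,ρ). -/
theorem cfg_nl_subset_pda (T : Type) [Fintype T] (σ : AccSigma) (ρ : AccRho) :
    GLang T OmegaPSG.IsCFG σ ρ DerivMode.nl ⊆ PDALang T σ ρ := by
  rintro L ⟨G, hG, rfl⟩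
  exact ⟨G.simPDA ρ, Set.ext fun u =>
    ⟨OmegaPSG.mem_simPDA_lang hG, OmegaPSG.mem_lang_of_mem_simPDA_lang⟩⟩
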